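/- arXiv:1901.00214 — 2 statements merged into one kernel-verified Lean document; each statement's English description precedes it below -/
import Mathlib

section
/- Suppose the finite multiset D ⊂ ℝ^p contains at least K distinct points. Then (i) any global minimizer x* = (x*^1,…,x*^K) of the K-means cost F satisfies x*^k ∈ closed convex hull of D for all k, and its K cluster centers are pairwise distinct (x*^k ≠ x*^{k'} for k ≠ k'); and (ii) if a pair (x*, P*) is a global minimizer of H over all center tuples and K-cell partitions of D, then the K centers x*^1,…,x*^K are pairwise distinct, each x*^k lies in the closed convex hull of D, and additionally P*^k ≠ ∅ for every k ∈ {1,…,K}. -/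
open scoped BigOperators

noncomputable section

/-! ### Basic (centralized) K-means notions -/

/-- The dataset `D` contains at least `K` distinct points. -/
def HasKDistinct {p : ℕ} (K : ℕ) (D : Multiset (EuclideanSpace ℝ (Fin p))) : Prop :=
  ∃ S : Finset (EuclideanSpace ℝ (Fin p)), S.card = K ∧ ∀ y ∈ S, y ∈ D

/-- The K-means clustering cost `F(x) = ∑_{y ∈ D} min_k ‖y - x^k‖²`. -/
def kmeansF {p : ℕ} (K : ℕ) (D : Multiset (EuclideanSpace ℝ (Fin p)))
    (x : Fin K → EuclideanSpace ℝ (Fin p)) : ℝ :=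
  (D.map fun y => ⨅ k : Fin K, ‖y - x k‖ ^ 2).sum

/-- `P` is a partition of the multiset `D` into `K` (possibly empty) cells. -/
def IsKPartition {p K : ℕ} (D : Multiset (EuclideanSpace ℝ (Fin p)))
    (P : Fin K → Multiset (EuclideanSpace ℝ (Fin p))) : Prop :=
  ∑ k, P k = D

/-- The distortion cost `H(x, P) = ∑_k ∑_{y ∈ P^k} ‖y - x^k‖²`. -/
def costH {p K : ℕ} (x : Fin K → EuclideanSpace ℝ (Fin p))
    (P : Fin K → Multiset (EuclideanSpace ℝ (Fin p))) : ℝ :=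
  ∑ k, ((P k).map fun y => ‖y - x k‖ ^ 2).sum

/-- `(x, P)` is a Lloyd's minimum for the dataset `D`. -/
def IsLloydMin {p K : ℕ} (D : Multiset (EuclideanSpace ℝ (Fin p)))
    (x : Fin K → EuclideanSpace ℝ (Fin p))
    (P : Fin K → Multiset (EuclideanSpace ℝ (Fin p))) : Prop :=
  IsKPartition D P ∧
    (∀ Q, IsKPartition D Q → costH x P ≤ costH x Q) ∧
    (∀ x', costH x P ≤ costH x' P)

/-- The set `Z` of Lloyd's minima (cluster-center tuples). -/
def LloydZ {p : ℕ} (K : ℕ) (D : Multiset (EuclideanSpace ℝ (Fin p))) :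
    Set (Fin K → EuclideanSpace ℝ (Fin p)) :=
  {x | ∃ P, IsLloydMin D x P}

/-- The set `Z̄` of Lloyd's minima whose centers lie in the (closed) convex hull of `D`. -/
def LloydZbar {p : ℕ} (K : ℕ) (D : Multiset (EuclideanSpace ℝ (Fin p))) :
    Set (Fin K → EuclideanSpace ℝ (Fin p)) :=
  {x ∈ LloydZ K D | ∀ k, x k ∈ convexHull ℝ {y | y ∈ D}}

/-- The set `Z_g` of global minimizers of the K-means cost `F`. -/
def kmeansZg {p : ℕ} (K : ℕ) (D : Multiset (EuclideanSpace ℝ (Fin p))) :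
    Set (Fin K → EuclideanSpace ℝ (Fin p)) :=
  {x | ∀ x', kmeansF K D x ≤ kmeansF K D x'}

/-- The global minimum value `F*` of the K-means cost. -/
def Fstar {p : ℕ} (K : ℕ) (D : Multiset (EuclideanSpace ℝ (Fin p))) : ℝ :=
  sInf (Set.range (kmeansF K D))

/-- `R₀ = max{‖v‖ : v ∈ closed convex hull of D}`. -/
def R0 {p : ℕ} (D : Multiset (EuclideanSpace ℝ (Fin p))) : ℝ :=
  sSup ((fun v => ‖v‖) '' convexHull ℝ {y | y ∈ D})

/-! ### Multi-agent notions -/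

section Distributed

variable {p K M : ℕ}

/-- The multi-agent cost `J^ρ(x, C)`; each undirected edge is counted once in the
agreement term. -/
def costJ (ρ : ℝ) (G : SimpleGraph (Fin M)) [DecidableRel G.Adj]
    (x : Fin M → Fin K → EuclideanSpace ℝ (Fin p))
    (C : Fin M → Fin K → Multiset (EuclideanSpace ℝ (Fin p))) : ℝ :=
  (1 / ρ) * ∑ m, ∑ k, ((C m k).map fun y => ‖y - x m k‖ ^ 2).sum +
    (1 / 2) * ∑ m, ∑ l ∈ G.neighborFinset m, ∑ k, ‖x m k - x l k‖ ^ 2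

/-- The multi-agent cost `Q^ρ(x)`. -/
def costQ (ρ : ℝ) (G : SimpleGraph (Fin M)) [DecidableRel G.Adj]
    (Dm : Fin M → Multiset (EuclideanSpace ℝ (Fin p)))
    (x : Fin M → Fin K → EuclideanSpace ℝ (Fin p)) : ℝ :=
  (1 / ρ) * ∑ m, ((Dm m).map fun y => ⨅ k : Fin K, ‖y - x m k‖ ^ 2).sum +
    (1 / 2) * ∑ m, ∑ l ∈ G.neighborFinset m, ∑ k, ‖x m k - x l k‖ ^ 2

/-- The set of global minimizers `M^ρ_g` of `Q^ρ`. -/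
def globQ (ρ : ℝ) (G : SimpleGraph (Fin M)) [DecidableRel G.Adj]
    (Dm : Fin M → Multiset (EuclideanSpace ℝ (Fin p))) (K : ℕ) :
    Set (Fin M → Fin K → EuclideanSpace ℝ (Fin p)) :=
  {x | ∀ x' : Fin M → Fin K → EuclideanSpace ℝ (Fin p), costQ ρ G Dm x ≤ costQ ρ G Dm x'}

/-- `C ∈ U_x` : `C` is an admissible (Voronoi / nearest-center) clustering for `x`. -/
def InVoronoi (Dm : Fin M → Multiset (EuclideanSpace ℝ (Fin p)))
    (x : Fin M → Fin K → EuclideanSpace ℝ (Fin p))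
    (C : Fin M → Fin K → Multiset (EuclideanSpace ℝ (Fin p))) : Prop :=
  (∀ m, IsKPartition (Dm m) (C m)) ∧
    ∀ m k y, y ∈ C m k → ∀ k', ‖y - x m k‖ ≤ ‖y - x m k'‖

/-- The fixed-point (stationarity) equations
`((1/ρ)|C_m^k| + |Ω_m|) x_m^k = (1/ρ) ∑_{y ∈ C_m^k} y + ∑_{l ∈ Ω_m} x_l^k`. -/
def IsFixedCenters (ρ : ℝ) (G : SimpleGraph (Fin M)) [DecidableRel G.Adj]
    (x : Fin M → Fin K → EuclideanSpace ℝ (Fin p))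
    (C : Fin M → Fin K → Multiset (EuclideanSpace ℝ (Fin p))) : Prop :=
  ∀ m k, ((1 / ρ) * ((C m k).card : ℝ) + (G.degree m : ℝ)) • x m k =
      (1 / ρ) • (C m k).sum + ∑ l ∈ G.neighborFinset m, x l k

/-- `(x, C)` is a generalized Lloyd's minimum of `J^ρ`. -/
def IsGenLloydMin (ρ : ℝ) (G : SimpleGraph (Fin M)) [DecidableRel G.Adj]
    (Dm : Fin M → Multiset (EuclideanSpace ℝ (Fin p)))
    (x : Fin M → Fin K → EuclideanSpace ℝ (Fin p))
    (C : Fin M → Fin K → Multiset (EuclideanSpace ℝ (Fin p))) : Prop :=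
  InVoronoi Dm x C ∧ IsFixedCenters ρ G x C

/-- The set `M^ρ` of generalized Lloyd's minima (centers part). -/
def genM (ρ : ℝ) (G : SimpleGraph (Fin M)) [DecidableRel G.Adj]
    (Dm : Fin M → Multiset (EuclideanSpace ℝ (Fin p))) (K : ℕ) :
    Set (Fin M → Fin K → EuclideanSpace ℝ (Fin p)) :=
  {x | ∃ C, IsGenLloydMin ρ G Dm x C}

/-- The set `M̄^ρ` of generalized Lloyd's minima with all centers in the (closed)
convex hull of the collective dataset `D`. -/
def genMbar (ρ : ℝ) (G : SimpleGraph (Fin M)) [DecidableRel G.Adj]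
    (Dm : Fin M → Multiset (EuclideanSpace ℝ (Fin p)))
    (D : Multiset (EuclideanSpace ℝ (Fin p))) (K : ℕ) :
    Set (Fin M → Fin K → EuclideanSpace ℝ (Fin p)) :=
  {x ∈ genM ρ G Dm K | ∀ m k, x m k ∈ convexHull ℝ {y | y ∈ D}}

/-- The update target
`μ_m^k = ((1/ρ) ∑_{y ∈ C_m^k} y + ∑_{l ∈ Ω_m} x_l^k) / ((1/ρ)|C_m^k| + |Ω_m|)`. -/
def muVec (ρ : ℝ) (G : SimpleGraph (Fin M)) [DecidableRel G.Adj]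
    (x : Fin M → Fin K → EuclideanSpace ℝ (Fin p))
    (C : Fin M → Fin K → Multiset (EuclideanSpace ℝ (Fin p)))
    (m : Fin M) (k : Fin K) : EuclideanSpace ℝ (Fin p) :=
  ((1 / ρ) * ((C m k).card : ℝ) + (G.degree m : ℝ))⁻¹ •
    ((1 / ρ) • (C m k).sum + ∑ l ∈ G.neighborFinset m, x l k)

/-- `(x_t, C_t)` is a trajectory of the NK-means algorithm with parameters `ρ, α`. -/
def NKMeansSeq (ρ α : ℝ) (G : SimpleGraph (Fin M)) [DecidableRel G.Adj]
    (Dm : Fin M → Multiset (EuclideanSpace ℝ (Fin p)))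
    (x : ℕ → Fin M → Fin K → EuclideanSpace ℝ (Fin p))
    (C : ℕ → Fin M → Fin K → Multiset (EuclideanSpace ℝ (Fin p))) : Prop :=
  (∀ m, IsKPartition (Dm m) (C 0 m)) ∧
    ∀ t, (∀ m, IsKPartition (Dm m) (C (t + 1) m)) ∧
      (∀ m k y, y ∈ C (t + 1) m k → ∀ k', ‖y - x t m k‖ ≤ ‖y - x t m k'‖) ∧
      ∀ m k, x (t + 1) m k = x t m k - α • (x t m k - muVec ρ G (x t) (C (t + 1)) m k)

/-- The minimum vertex degree `d_min` of the communication graph. -/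
def minDeg (G : SimpleGraph (Fin M)) [DecidableRel G.Adj] : ℕ :=
  sInf (Set.range fun m : Fin M => G.degree m)

/-- The largest eigenvalue `λ_M(L)` of the graph Laplacian. -/
def lapLamMax (G : SimpleGraph (Fin M)) [DecidableRel G.Adj] : ℝ :=
  sSup (spectrum ℝ (G.lapMatrix ℝ))

/-- The second-smallest eigenvalue `λ₂(L)` of the graph Laplacian (for a connected
graph, the smallest nonzero eigenvalue). -/
def lapLam2 (G : SimpleGraph (Fin M)) [DecidableRel G.Adj] : ℝ :=
  sInf {μ : ℝ | μ ∈ spectrum ℝ (G.lapMatrix ℝ) ∧ μ ≠ 0}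

/-- `N* = max_m |D_m|`. -/
def Nstar (Dm : Fin M → Multiset (EuclideanSpace ℝ (Fin p))) : ℕ :=
  Finset.univ.sup fun m => (Dm m).card

/-- The step-size condition `0 < α < d_min / ((1/ρ) N* + λ_M(L))`. -/
def StepOK (ρ α : ℝ) (G : SimpleGraph (Fin M)) [DecidableRel G.Adj]
    (Dm : Fin M → Multiset (EuclideanSpace ℝ (Fin p))) : Prop :=
  0 < α ∧ α * ((1 / ρ) * (Nstar Dm : ℝ) + lapLamMax G) < (minDeg G : ℝ)

/-- The constant `c(α) = 2α(d_min − α((1/ρ)N* + λ_M(L)))`. -/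
def cAlpha (ρ α : ℝ) (G : SimpleGraph (Fin M)) [DecidableRel G.Adj]
    (Dm : Fin M → Multiset (EuclideanSpace ℝ (Fin p))) : ℝ :=
  2 * α * ((minDeg G : ℝ) - α * ((1 / ρ) * (Nstar Dm : ℝ) + lapLamMax G))

end Distributed
section Minimizers

variable {p K : ℕ}

theorem iInf_norm_sub_sq_le (x : Fin K → EuclideanSpace ℝ (Fin p))
    (y : EuclideanSpace ℝ (Fin p)) (k : Fin K) :
    ⨅ i, ‖y - x i‖ ^ 2 ≤ ‖y - x k‖ ^ 2 :=
  ciInf_le (Set.finite_range _).bddBelow k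

/-- Moving a point outside a closed convex set to its projection brings it strictly closer to
every point of the set. -/
theorem exists_mem_forall_norm_sub_lt {E : Type*} [NormedAddCommGroup E] [InnerProductSpace ℝ E]
    {C : Set E} (hne : C.Nonempty) (hcomplete : IsComplete C) (hconv : Convex ℝ C)
    {u : E} (hu : u ∉ C) : ∃ v ∈ C, ∀ w ∈ C, ‖w - v‖ < ‖w - u‖ := by
  obtain ⟨v, hv, hmin⟩ := exists_norm_eq_iInf_of_complete_convex hne hcomplete hconv u
  rw [norm_eq_iInf_iff_real_inner_le_zero hconv hv] at hmin
  refine ⟨v, hv, fun w hw => lt_of_pow_lt_pow_left₀ 2 (norm_nonneg _) ?_⟩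
  have hpos : 0 < ‖u - v‖ := norm_pos_iff.2 (sub_ne_zero.2 fun h => hu (h ▸ hv))
  have hexp := norm_sub_sq_real (w - v) (u - v)
  rw [sub_sub_sub_cancel_right, real_inner_comm] at hexp
  nlinarith [hmin w hw, pow_pos hpos 2]

/-- At a minimizer of the K-means cost, each center is the unique nearest center of some data
point. -/
theorem exists_forall_norm_sub_lt_of_isMin {D : Multiset (EuclideanSpace ℝ (Fin p))}
    (hdistinct : HasKDistinct K D) {x : Fin K → EuclideanSpace ℝ (Fin p)}
    (hx : ∀ x', kmeansF K D x ≤ kmeansF K D x') (j : Fin K) :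
    ∃ y ∈ D, ∀ k, k ≠ j → ‖y - x j‖ < ‖y - x k‖ := by
  classical
  have : Nonempty (Fin K) := ⟨j⟩
  by_contra! hred
  obtain ⟨S, hcard, hSD⟩ := hdistinct
  obtain ⟨s, hsS, hs⟩ : ∃ s ∈ S, s ∉ (Finset.univ.erase j).image x := by
    refine Finset.exists_mem_notMem_of_card_lt_card (Finset.card_image_le.trans_lt ?_)
    rw [hcard]
    simpa using Finset.card_erase_lt_of_mem (Finset.mem_univ j)
  have hne : ∀ k, k ≠ j → s ≠ x k := fun k hk h =>
    hs (Finset.mem_image.2 ⟨k, Finset.mem_erase.2 ⟨hk, Finset.mem_univ k⟩, h.symm⟩)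
  have hle : ∀ y ∈ D, ∀ k, ∃ i, i ≠ j ∧ ‖y - x i‖ ^ 2 ≤ ‖y - x k‖ ^ 2 := by
    intro y hy k
    by_cases hk : k = j
    · obtain ⟨i, hi, hle⟩ := hred y hy
      exact ⟨i, hi, hk ▸ pow_le_pow_left₀ (norm_nonneg _) hle 2⟩
    · exact ⟨k, hk, le_rfl⟩
  refine (hx (Function.update x j s)).not_gt (Multiset.sum_lt_sum (fun y hy => ?_)
    ⟨s, hSD s hsS, ?_⟩)
  · refine le_ciInf fun k => ?_
    obtain ⟨i, hi, hik⟩ := hle y hy k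
    refine le_trans ?_ hik
    simpa [hi] using iInf_norm_sub_sq_le (Function.update x j s) y i
  · have hzero := iInf_norm_sub_sq_le (Function.update x j s) s j
    rw [Function.update_self, sub_self, norm_zero, zero_pow two_ne_zero] at hzero
    refine hzero.trans_lt ?_
    obtain ⟨k, hk⟩ := exists_eq_ciInf_of_finite (f := fun i => ‖s - x i‖ ^ 2)
    obtain ⟨i, hi, hik⟩ := hle s (hSD s hsS) k
    exact (pow_pos (norm_pos_iff.2 (sub_ne_zero.2 (hne i hi))) 2).trans_le (hik.trans hk.le)

theorem injective_of_isMin_kmeansF {D : Multiset (EuclideanSpace ℝ (Fin p))}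
    (hdistinct : HasKDistinct K D) {x : Fin K → EuclideanSpace ℝ (Fin p)}
    (hx : ∀ x', kmeansF K D x ≤ kmeansF K D x') : Function.Injective x := by
  intro i j hij
  by_contra hne
  obtain ⟨y, -, hy⟩ := exists_forall_norm_sub_lt_of_isMin hdistinct hx j
  exact (hy i hne).ne (by rw [hij])

theorem mem_convexHull_of_isMin_kmeansF {D : Multiset (EuclideanSpace ℝ (Fin p))}
    (hdistinct : HasKDistinct K D) {x : Fin K → EuclideanSpace ℝ (Fin p)}
    (hx : ∀ x', kmeansF K D x ≤ kmeansF K D x') (j : Fin K) :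
    x j ∈ convexHull ℝ {y | y ∈ D} := by
  have : Nonempty (Fin K) := ⟨j⟩
  by_contra hj
  obtain ⟨s, hs, hnear⟩ := exists_forall_norm_sub_lt_of_isMin hdistinct hx j
  have hsub : {y | y ∈ D} ⊆ convexHull ℝ {y | y ∈ D} := subset_convexHull ℝ _
  obtain ⟨v, -, hv⟩ := exists_mem_forall_norm_sub_lt ⟨s, hsub hs⟩
    ((Multiset.finite_toSet D).isCompact_convexHull ℝ).isComplete (convex_convexHull ℝ _) hj
  have hvsq : ∀ y ∈ D, ⨅ k, ‖y - Function.update x j v k‖ ^ 2 < ‖y - x j‖ ^ 2 := fun y hy =>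
    (iInf_norm_sub_sq_le _ y j).trans_lt (by
      rw [Function.update_self]
      exact pow_lt_pow_left₀ (hv y (hsub hy)) (norm_nonneg _) two_ne_zero)
  refine (hx (Function.update x j v)).not_gt (Multiset.sum_lt_sum (fun y hy => ?_) ⟨s, hs, ?_⟩)
  · refine le_ciInf fun k => ?_
    by_cases hk : k = j
    · exact hk ▸ (hvsq y hy).le
    · simpa [hk] using iInf_norm_sub_sq_le (Function.update x j v) y k
  · refine (hvsq s hs).trans_le (le_ciInf fun k => ?_)
    by_cases hk : k = j
    · rw [hk]
    · exact pow_le_pow_left₀ (norm_nonneg _) (hnear k hk).le 2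

theorem IsKPartition.kmeansF_eq {D : Multiset (EuclideanSpace ℝ (Fin p))}
    {P : Fin K → Multiset (EuclideanSpace ℝ (Fin p))} (hP : IsKPartition D P)
    (x : Fin K → EuclideanSpace ℝ (Fin p)) :
    kmeansF K D x = ∑ k, ((P k).map fun y => ⨅ i, ‖y - x i‖ ^ 2).sum := by
  rw [← hP]
  exact map_sum (Multiset.sumAddMonoidHom.comp
    (Multiset.mapAddMonoidHom fun y => ⨅ i, ‖y - x i‖ ^ 2)) P Finset.univ

theorem IsKPartition.kmeansF_le_costH {D : Multiset (EuclideanSpace ℝ (Fin p))}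
    {P : Fin K → Multiset (EuclideanSpace ℝ (Fin p))} (hP : IsKPartition D P)
    (x : Fin K → EuclideanSpace ℝ (Fin p)) : kmeansF K D x ≤ costH x P := by
  rw [hP.kmeansF_eq]
  exact Finset.sum_le_sum fun k _ =>
    Multiset.sum_map_le_sum_map _ _ fun y _ => iInf_norm_sub_sq_le x y k

/-- Assigning each data point to a nearest center turns the distortion cost into the K-means
cost. -/
theorem exists_isKPartition_costH_eq [Nonempty (Fin K)]
    (D : Multiset (EuclideanSpace ℝ (Fin p))) (x : Fin K → EuclideanSpace ℝ (Fin p)) :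
    ∃ P, IsKPartition D P ∧ costH x P = kmeansF K D x := by
  classical
  choose f hf using fun y : EuclideanSpace ℝ (Fin p) =>
    exists_eq_ciInf_of_finite (f := fun i => ‖y - x i‖ ^ 2)
  have hP : IsKPartition D fun k => D.filter fun y => f y = k := by
    ext y
    simp [Multiset.count_sum', Multiset.count_filter]
  refine ⟨_, hP, ?_⟩
  rw [hP.kmeansF_eq]
  refine Finset.sum_congr rfl fun k _ => congrArg _ (Multiset.map_congr rfl fun y hy => ?_)
  rw [← hf y, (Multiset.mem_filter.1 hy).2]

end Minimizers

/-- Proposition 1: properties of global minimizers of the K-means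
cost `F` and of the joint cost `H`. -/
theorem stmt0 {p K : ℕ} (hK2 : 2 ≤ K)
    (D : Multiset (EuclideanSpace ℝ (Fin p)))
    (hKN : K ≤ Multiset.card D)
    (hdistinct : HasKDistinct K D) :
    (∀ x : Fin K → EuclideanSpace ℝ (Fin p),
        (∀ x' : Fin K → EuclideanSpace ℝ (Fin p), kmeansF K D x ≤ kmeansF K D x') →
        (∀ k, x k ∈ convexHull ℝ {y | y ∈ D}) ∧ Function.Injective x) ∧
      (∀ (x : Fin K → EuclideanSpace ℝ (Fin p))
          (P : Fin K → Multiset (EuclideanSpace ℝ (Fin p))),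
        IsKPartition D P →
        (∀ (x' : Fin K → EuclideanSpace ℝ (Fin p))
            (P' : Fin K → Multiset (EuclideanSpace ℝ (Fin p))),
          IsKPartition D P' → costH x P ≤ costH x' P') →
        Function.Injective x ∧ (∀ k, x k ∈ convexHull ℝ {y | y ∈ D}) ∧ ∀ k, P k ≠ 0) := by
  have : Nonempty (Fin K) := ⟨⟨0, by omega⟩⟩
  refine ⟨fun x hx => ⟨mem_convexHull_of_isMin_kmeansF hdistinct hx,
    injective_of_isMin_kmeansF hdistinct hx⟩, fun x P hP hmin => ?_⟩
  have hle : ∀ x', costH x P ≤ kmeansF K D x' := fun x' => by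
    obtain ⟨Q, hQ, hcost⟩ := exists_isKPartition_costH_eq D x'
    exact hcost ▸ hmin x' Q hQ
  have hx : ∀ x', kmeansF K D x ≤ kmeansF K D x' := fun x' =>
    (hP.kmeansF_le_costH x).trans (hle x')
  refine ⟨injective_of_isMin_kmeansF hdistinct hx, mem_convexHull_of_isMin_kmeansF hdistinct hx,
    fun j hj => ?_⟩
  obtain ⟨s, hs, hnear⟩ := exists_forall_norm_sub_lt_of_isMin hdistinct hx j
  rw [← hP, Multiset.mem_sum] at hs
  obtain ⟨k, -, hsk⟩ := hs
  have hkj : k ≠ j := by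
    rintro rfl
    simp [hj] at hsk
  refine (hle x).not_gt ?_
  rw [hP.kmeansF_eq]
  refine Finset.sum_lt_sum (fun i _ => Multiset.sum_map_le_sum_map _ _ fun y _ =>
    iInf_norm_sub_sq_le x y i) ⟨k, Finset.mem_univ k, Multiset.sum_lt_sum
      (fun y _ => iInf_norm_sub_sq_le x y k) ⟨s, hsk, ?_⟩⟩
  exact (iInf_norm_sub_sq_le x s j).trans_lt
    (pow_lt_pow_left₀ (hnear k hkj) (norm_nonneg _) two_ne_zero)
end
end

section
/- Let the dataset contain at least K distinct points and the communication graph be connected. Then the convergence of global minimizers of Q^ρ to global K-means minimizers is uniform: for every ε > 0 there exists ρ_ε > 0 (depending only on the dataset D and the graph G) such that for all ρ ≥ ρ_ε, every x̆ ∈ M^ρ_g, and every agent m ∈ {1,…,M}, d(x̆_m, Z_g) ≤ ε. Equivalently, lim_{ρ→∞} sup_{x̆∈M^ρ_g} max_{1≤m≤M} d(x̆_m, Z_g) = 0. -/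
open scoped BigOperators

noncomputable section

section Auxiliary

variable {p K : ℕ}

theorem iInf_sq_le (x : Fin K → EuclideanSpace ℝ (Fin p)) (y : EuclideanSpace ℝ (Fin p))
    (k : Fin K) : ⨅ k, ‖y - x k‖ ^ 2 ≤ ‖y - x k‖ ^ 2 :=
  ciInf_le (Set.finite_range _).bddBelow k

theorem iInf_sq_nonneg (x : Fin K → EuclideanSpace ℝ (Fin p)) (y : EuclideanSpace ℝ (Fin p)) :
    0 ≤ ⨅ k, ‖y - x k‖ ^ 2 :=
  Real.iInf_nonneg fun _ => sq_nonneg _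

theorem kmeansF_nonneg (D : Multiset (EuclideanSpace ℝ (Fin p)))
    (x : Fin K → EuclideanSpace ℝ (Fin p)) : 0 ≤ kmeansF K D x := by
  refine Multiset.sum_nonneg fun a ha => ?_
  obtain ⟨y, -, rfl⟩ := Multiset.mem_map.1 ha
  exact iInf_sq_nonneg x y

theorem kmeansF_cons (y : EuclideanSpace ℝ (Fin p)) (D : Multiset (EuclideanSpace ℝ (Fin p)))
    (x : Fin K → EuclideanSpace ℝ (Fin p)) :
    kmeansF K (y ::ₘ D) x = (⨅ k, ‖y - x k‖ ^ 2) + kmeansF K D x := by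
  simp [kmeansF]

theorem iInf_sq_le_kmeansF {D : Multiset (EuclideanSpace ℝ (Fin p))}
    (x : Fin K → EuclideanSpace ℝ (Fin p)) {y : EuclideanSpace ℝ (Fin p)} (hy : y ∈ D) :
    ⨅ k, ‖y - x k‖ ^ 2 ≤ kmeansF K D x := by
  obtain ⟨D', rfl⟩ := Multiset.exists_cons_of_mem hy
  rw [kmeansF_cons]
  linarith [kmeansF_nonneg D' x]

theorem kmeansF_sum {ι : Type*} (s : Finset ι)
    (Dm : ι → Multiset (EuclideanSpace ℝ (Fin p))) (x : Fin K → EuclideanSpace ℝ (Fin p)) :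
    kmeansF K (∑ m ∈ s, Dm m) x = ∑ m ∈ s, kmeansF K (Dm m) x := by
  classical
  induction s using Finset.induction_on with
  | empty => simp [kmeansF]
  | insert a s ha ih =>
    rw [Finset.sum_insert ha, Finset.sum_insert ha, ← ih]
    simp [kmeansF]

theorem continuous_kmeansF (hK : 0 < K) (D : Multiset (EuclideanSpace ℝ (Fin p))) :
    Continuous (kmeansF K D) := by
  have : Nonempty (Fin K) := ⟨⟨0, hK⟩⟩
  refine continuous_multiset_sum _ fun y _ => ?_
  simp_rw [← Finset.inf'_univ_eq_ciInf]
  exact Continuous.finset_inf'_apply _ fun k _ => by fun_prop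

theorem bddBelow_range_kmeansF (D : Multiset (EuclideanSpace ℝ (Fin p))) :
    BddBelow (Set.range (kmeansF K D)) :=
  ⟨0, by rintro _ ⟨x, rfl⟩; exact kmeansF_nonneg D x⟩

theorem Fstar_le (D : Multiset (EuclideanSpace ℝ (Fin p)))
    (x : Fin K → EuclideanSpace ℝ (Fin p)) : Fstar K D ≤ kmeansF K D x :=
  csInf_le (bddBelow_range_kmeansF D) ⟨x, rfl⟩

theorem le_Fstar {D : Multiset (EuclideanSpace ℝ (Fin p))} {a : ℝ}
    (h : ∀ x, a ≤ kmeansF K D x) : a ≤ Fstar K D :=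
  le_csInf (Set.range_nonempty _) (by rintro _ ⟨x, rfl⟩; exact h x)

/-- Among `K` points at mutual distance at least `s`, one stays at distance at least `s / 2`
from any `K - 1` given centers. -/
theorem exists_mem_far_from_other_centers {S : Finset (EuclideanSpace ℝ (Fin p))}
    (hS : S.card = K) {s : ℝ} (hsep : ∀ y ∈ S, ∀ z ∈ S, y ≠ z → s ≤ dist y z)
    (x : Fin K → EuclideanSpace ℝ (Fin p)) (k₀ : Fin K) :
    ∃ z ∈ S, ∀ j, j ≠ k₀ → s / 2 ≤ ‖z - x j‖ := by
  classical
  by_contra! h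
  have : Nonempty (Fin K) := ⟨k₀⟩
  choose! f hf hlt using h
  have hcard : (Finset.univ.erase k₀).card < S.card := by
    rw [Finset.card_erase_of_mem (Finset.mem_univ _), Finset.card_univ, Fintype.card_fin, hS]
    have := k₀.2
    omega
  obtain ⟨y, hy, z, hz, hyz, hfe⟩ := Finset.exists_ne_map_eq_of_card_lt_of_maps_to hcard
    (f := f) fun y hy => Finset.mem_coe.2 (Finset.mem_erase.2 ⟨hf y hy, Finset.mem_univ _⟩)
  have h1 := hlt y hy
  have h2 := hlt z hz
  rw [← hfe, ← dist_eq_norm] at h2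
  rw [← dist_eq_norm] at h1
  have := dist_triangle_right y z (x (f y))
  linarith [hsep y hy z hz hyz]

/-- If the center `k₀` is not needed to realize the cost, moving it onto a data point far from
all other centers decreases the cost. -/
theorem kmeansF_update_add_le {D : Multiset (EuclideanSpace ℝ (Fin p))}
    (x : Fin K → EuclideanSpace ℝ (Fin p)) (k₀ : Fin K)
    (hx : ∀ y ∈ D, ∃ j, j ≠ k₀ ∧ ‖y - x j‖ ^ 2 = ⨅ k, ‖y - x k‖ ^ 2)
    {z : EuclideanSpace ℝ (Fin p)} (hz : z ∈ D) {r : ℝ} (hr : 0 ≤ r)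
    (hfar : ∀ j, j ≠ k₀ → r ≤ ‖z - x j‖) :
    kmeansF K D (Function.update x k₀ z) + r ^ 2 ≤ kmeansF K D x := by
  have hle : ∀ y ∈ D, ⨅ k, ‖y - Function.update x k₀ z k‖ ^ 2 ≤ ⨅ k, ‖y - x k‖ ^ 2 := by
    intro y hy
    obtain ⟨j, hj, hjy⟩ := hx y hy
    have := iInf_sq_le (Function.update x k₀ z) y j
    rwa [Function.update_of_ne hj, hjy] at this
  have hz0 : ⨅ k, ‖z - Function.update x k₀ z k‖ ^ 2 ≤ 0 := by
    simpa using iInf_sq_le (Function.update x k₀ z) z k₀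
  have hzx : r ^ 2 ≤ ⨅ k, ‖z - x k‖ ^ 2 := by
    obtain ⟨j, hj, hjz⟩ := hx z hz
    rw [← hjz]
    exact pow_le_pow_left₀ hr (hfar j hj) 2
  obtain ⟨D', rfl⟩ := Multiset.exists_cons_of_mem hz
  have hrest : kmeansF K D' (Function.update x k₀ z) ≤ kmeansF K D' x :=
    Multiset.sum_map_le_sum_map _ _ fun y hy => hle y (Multiset.mem_cons_of_mem hy)
  rw [kmeansF_cons, kmeansF_cons]
  linarith

theorem exists_norm_le_of_kmeansF_lt (hK2 : 2 ≤ K) {D : Multiset (EuclideanSpace ℝ (Fin p))}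
    (hdistinct : HasKDistinct K D) :
    ∃ c : ℝ, 0 < c ∧ ∃ R : ℝ, ∀ x, kmeansF K D x < Fstar K D + c → ∀ k, ‖x k‖ ≤ R := by
  classical
  have : Nonempty (Fin K) := ⟨⟨0, by omega⟩⟩
  obtain ⟨S, hS, hSD⟩ := hdistinct
  have hnontriv : (S : Set (EuclideanSpace ℝ (Fin p))).Nontrivial :=
    Finset.one_lt_card_iff_nontrivial.1 (by omega)
  obtain ⟨s, hs, hsep⟩ : ∃ s : ℝ, 0 < s ∧ ∀ y ∈ S, ∀ z ∈ S, y ≠ z → s ≤ dist y z :=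
    ⟨Set.infsep (S : Set (EuclideanSpace ℝ (Fin p))),
      S.finite_toSet.infsep_pos_iff_nontrivial.2 hnontriv,
      fun y hy z hz hyz => Set.infsep_le_dist_of_mem hy hz hyz⟩
  obtain ⟨r, hr⟩ : ∃ r : ℝ, ∀ y ∈ D, ‖y‖ ≤ r := by
    obtain ⟨r, hr⟩ := (D.toFinset.finite_toSet).isBounded.exists_norm_le
    exact ⟨r, fun y hy => hr y (by simpa using hy)⟩
  have hF : 0 ≤ Fstar K D := le_Fstar (kmeansF_nonneg D)
  refine ⟨(s / 2) ^ 2, by positivity, r + √(Fstar K D + (s / 2) ^ 2), fun x hx k₀ => ?_⟩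
  by_contra! hk
  refine hx.not_ge ?_
  by_cases h : ∃ y ∈ D, ‖y - x k₀‖ ^ 2 = ⨅ k, ‖y - x k‖ ^ 2
  · obtain ⟨y, hy, hyk⟩ := h
    refine le_trans ?_ (iInf_sq_le_kmeansF x hy)
    rw [← hyk]
    refine (Real.sqrt_le_left (norm_nonneg _)).1 ?_
    have := norm_le_norm_add_norm_sub y (x k₀)
    linarith [hr y hy]
  · push Not at h
    obtain ⟨z, hzS, hz⟩ := exists_mem_far_from_other_centers hS hsep x k₀
    have := kmeansF_update_add_le x k₀ (fun y hy => ?_) (hSD z hzS) (by positivity) hz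
    · linarith [Fstar_le D (Function.update x k₀ z)]
    · obtain ⟨j, hj⟩ := exists_eq_ciInf_of_finite (f := fun k => ‖y - x k‖ ^ 2)
      exact ⟨j, fun hjk => h y hy (hjk ▸ hj), hj⟩

/-- Tuples whose cost is nearly optimal are close to optimal tuples. -/
theorem exists_infDist_kmeansZg_le (hK2 : 2 ≤ K) {D : Multiset (EuclideanSpace ℝ (Fin p))}
    (hdistinct : HasKDistinct K D) {ε : ℝ} (hε : 0 < ε) :
    ∃ δ : ℝ, 0 < δ ∧ ∀ x, kmeansF K D x < Fstar K D + δ →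
      Metric.infDist x (kmeansZg K D) ≤ ε := by
  obtain ⟨c, hc, R, hR⟩ := exists_norm_le_of_kmeansF_lt hK2 hdistinct
  have hcont := continuous_kmeansF (show 0 < K by omega) D
  set A : Set (Fin K → EuclideanSpace ℝ (Fin p)) :=
    {x | ‖x‖ ≤ max R 0 ∧ ε ≤ Metric.infDist x (kmeansZg K D)} with hA
  have hAc : IsCompact A := by
    have hball := isCompact_closedBall (0 : Fin K → EuclideanSpace ℝ (Fin p)) (max R 0)
    refine hball.of_isClosed_subset ?_ fun x hx => by simpa using hx.1
    exact (isClosed_le continuous_norm continuous_const).inter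
      (isClosed_le continuous_const (Metric.continuous_infDist_pt _))
  have hmem : ∀ x, kmeansF K D x < Fstar K D + c →
      ε < Metric.infDist x (kmeansZg K D) → x ∈ A := fun x hx hd =>
    ⟨(pi_norm_le_iff_of_nonneg (le_max_right _ _)).2 fun k =>
      (hR x hx k).trans (le_max_left _ _), hd.le⟩
  rcases A.eq_empty_or_nonempty with hAe | hAn
  · refine ⟨c, hc, fun x hx => ?_⟩
    by_contra! hd
    simpa [hAe] using hmem x hx hd
  · obtain ⟨a, haA, ha⟩ := hAc.exists_isMinOn hAn hcont.continuousOn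
    have hlt : Fstar K D < kmeansF K D a := by
      refine lt_of_le_of_ne (Fstar_le D a) fun heq => ?_
      have haZ : a ∈ kmeansZg K D := fun x' => heq ▸ Fstar_le D x'
      have := haA.2
      rw [Metric.infDist_zero_of_mem haZ] at this
      linarith
    refine ⟨min c (kmeansF K D a - Fstar K D), lt_min hc (by linarith), fun x hx => ?_⟩
    by_contra! hd
    have h1 := min_le_left c (kmeansF K D a - Fstar K D)
    have h2 := min_le_right c (kmeansF K D a - Fstar K D)
    have := isMinOn_iff.1 ha x (hmem x (by linarith) hd)
    linarith

theorem kmeansF_le_of_norm_sub_le (hK : 0 < K) (D : Multiset (EuclideanSpace ℝ (Fin p)))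
    {x x' : Fin K → EuclideanSpace ℝ (Fin p)} {η : ℝ} (hη1 : η ≤ 1)
    (h : ∀ k, ‖x' k - x k‖ ≤ η) :
    kmeansF K D x ≤ (1 + η) * kmeansF K D x' + 2 * η * D.card := by
  have : Nonempty (Fin K) := ⟨⟨0, hK⟩⟩
  have hη : 0 ≤ η := (norm_nonneg _).trans (h ⟨0, hK⟩)
  induction D using Multiset.induction_on with
  | empty => simp [kmeansF]
  | cons y D ih =>
    rw [kmeansF_cons, kmeansF_cons, Multiset.card_cons]
    push_cast
    obtain ⟨k, hk⟩ := exists_eq_ciInf_of_finite (f := fun k => ‖y - x' k‖ ^ 2)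
    have h1 := iInf_sq_le x y k
    have h2 : ‖y - x k‖ ≤ ‖y - x' k‖ + η :=
      (norm_sub_le_norm_sub_add_norm_sub y (x' k) (x k)).trans (by linarith [h k])
    have h3 := pow_le_pow_left₀ (norm_nonneg _) h2 2
    have h4 : (‖y - x' k‖ + η) ^ 2 ≤ (1 + η) * ‖y - x' k‖ ^ 2 + 2 * η := by
      nlinarith [mul_nonneg hη (sq_nonneg (‖y - x' k‖ - 1)), mul_nonneg hη (sub_nonneg.2 hη1)]
    rw [← hk]
    linarith

end Auxiliary

section Agents

variable {p K M : ℕ}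

theorem norm_sub_le_walk_length_mul {V E : Type*} [SeminormedAddCommGroup E]
    {G : SimpleGraph V} {f : V → E} {h : ℝ} (hf : ∀ u v, G.Adj u v → ‖f u - f v‖ ≤ h)
    {u v : V} (w : G.Walk u v) : ‖f u - f v‖ ≤ w.length * h := by
  induction w with
  | nil => simp
  | cons hadj w ih =>
    rw [SimpleGraph.Walk.length_cons]
    push_cast
    have := norm_sub_le_norm_sub_add_norm_sub (f _) (f _) (f _) |>.trans
      (add_le_add (hf _ _ hadj) ih)
    linarith

theorem globQ_cost_le_Fstar (Dm : Fin M → Multiset (EuclideanSpace ℝ (Fin p)))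
    (G : SimpleGraph (Fin M)) [DecidableRel G.Adj] {ρ : ℝ} (hρ : 0 < ρ)
    {x : Fin M → Fin K → EuclideanSpace ℝ (Fin p)} (hx : x ∈ globQ ρ G Dm K) :
    ∑ m, kmeansF K (Dm m) (x m) +
      ρ / 2 * ∑ m, ∑ l ∈ G.neighborFinset m, ∑ k, ‖x m k - x l k‖ ^ 2 ≤
        Fstar K (∑ m, Dm m) := by
  refine le_Fstar fun x' => ?_
  rw [kmeansF_sum]
  have := mul_le_mul_of_nonneg_left (hx fun _ => x') hρ.le
  simp only [costQ, ← kmeansF.eq_1, sub_self, norm_zero, ne_eq, OfNat.ofNat_ne_zero,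
    not_false_eq_true, zero_pow, Finset.sum_const_zero, mul_zero, add_zero] at this
  rw [mul_add, ← mul_assoc, ← mul_assoc, ← mul_assoc, mul_one_div_cancel hρ.ne', one_mul,
    one_mul] at this
  linarith

theorem norm_sub_sq_le_of_adj (G : SimpleGraph (Fin M)) [DecidableRel G.Adj]
    (x : Fin M → Fin K → EuclideanSpace ℝ (Fin p)) {m l : Fin M} (hml : G.Adj m l)
    (k : Fin K) :
    ‖x m k - x l k‖ ^ 2 ≤ ∑ m, ∑ l ∈ G.neighborFinset m, ∑ k, ‖x m k - x l k‖ ^ 2 :=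
  calc ‖x m k - x l k‖ ^ 2 ≤ ∑ k, ‖x m k - x l k‖ ^ 2 :=
        Finset.single_le_sum (f := fun k => ‖x m k - x l k‖ ^ 2)
          (fun _ _ => by positivity) (Finset.mem_univ k)
    _ ≤ ∑ l ∈ G.neighborFinset m, ∑ k, ‖x m k - x l k‖ ^ 2 :=
        Finset.single_le_sum (f := fun l => ∑ k, ‖x m k - x l k‖ ^ 2)
          (fun _ _ => by positivity) ((G.mem_neighborFinset _ _).2 hml)
    _ ≤ _ := Finset.single_le_sum
          (f := fun m => ∑ l ∈ G.neighborFinset m, ∑ k, ‖x m k - x l k‖ ^ 2)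
          (fun _ _ => by positivity) (Finset.mem_univ m)

end Agents

/-- Corollary 5: uniform convergence of the global minimizers of
`Q^ρ` to the set `Z_g` of global K-means minimizers. -/
theorem stmt5 {p K M : ℕ} (hK2 : 2 ≤ K)
    (Dm : Fin M → Multiset (EuclideanSpace ℝ (Fin p)))
    (D : Multiset (EuclideanSpace ℝ (Fin p))) (hD : ∑ m, Dm m = D)
    (hdistinct : HasKDistinct K D)
    (G : SimpleGraph (Fin M)) [DecidableRel G.Adj] (hconn : G.Connected) :
    ∀ ε : ℝ, 0 < ε → ∃ ρε : ℝ, 0 < ρε ∧ ∀ ρ : ℝ, ρε ≤ ρ →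
      ∀ x ∈ globQ ρ G Dm K, ∀ m, Metric.infDist (x m) (kmeansZg K D) ≤ ε := by
  intro ε hε
  obtain ⟨δ, hδ, hclose⟩ := exists_infDist_kmeansZg_le hK2 hdistinct hε
  set Fs := Fstar K D with hFs
  have hFs0 : 0 ≤ Fs := le_Fstar (kmeansF_nonneg D)
  set T : ℝ := Fs + 2 * D.card + 1 with hT
  have hT0 : 0 < T := by positivity
  set η : ℝ := min 1 (δ / (2 * T)) with hη
  have hη0 : 0 < η := lt_min one_pos (by positivity)
  have hηT : η * T < δ := by
    have : η * (2 * T) ≤ δ := (le_div_iff₀ (by positivity)).1 (min_le_right _ _)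
    nlinarith [mul_pos hη0 hT0]
  set h : ℝ := η / (M + 1) with hh
  have hh0 : 0 < h := by positivity
  refine ⟨2 * Fs / h ^ 2 + 1, by positivity, fun ρ hρ x hx m => hclose _ ?_⟩
  have hρ0 : 0 < ρ := lt_of_lt_of_le (by positivity) hρ
  have hρh : 2 * Fs ≤ ρ * h ^ 2 := (div_le_iff₀ (by positivity)).1 (by linarith)
  have hQ := globQ_cost_le_Fstar Dm G hρ0 hx
  rw [hD] at hQ
  have hsum0 : 0 ≤ ∑ m, kmeansF K (Dm m) (x m) :=
    Finset.sum_nonneg fun m _ => kmeansF_nonneg _ _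
  have hadj : ∀ k u v, G.Adj u v → ‖x u k - x v k‖ ≤ h := by
    intro k u v huv
    refine abs_le_of_sq_le_sq' ?_ hh0.le |>.2
    have := mul_le_mul_of_nonneg_left (norm_sub_sq_le_of_adj G x huv k) hρ0.le
    exact le_of_mul_le_mul_left (by linarith) hρ0
  have hdist : ∀ l k, ‖x l k - x m k‖ ≤ η := by
    intro l k
    obtain ⟨w, hw⟩ := (hconn.preconnected l m).exists_isPath
    have hlen : (w.length : ℝ) ≤ M := by
      have := hw.length_lt
      rw [Fintype.card_fin] at this
      exact_mod_cast this.le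
    calc ‖x l k - x m k‖ ≤ w.length * h :=
          norm_sub_le_walk_length_mul (f := fun u => x u k) (hadj k) w
      _ ≤ (M + 1) * h := by gcongr; linarith
      _ = η := by rw [hh]; field_simp
  have hcard : (D.card : ℝ) = ∑ l, ((Dm l).card : ℝ) := by
    rw [← hD, Multiset.card_sum]; push_cast; rfl
  have hA : 0 ≤ ∑ m, ∑ l ∈ G.neighborFinset m, ∑ k, ‖x m k - x l k‖ ^ 2 := by positivity
  have hsumle : ∑ l, kmeansF K (Dm l) (x l) ≤ Fs := by
    linarith [mul_nonneg (half_pos hρ0).le hA]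
  calc kmeansF K D (x m) = ∑ l, kmeansF K (Dm l) (x m) := by rw [← hD, kmeansF_sum]
    _ ≤ ∑ l, ((1 + η) * kmeansF K (Dm l) (x l) + 2 * η * (Dm l).card) :=
        Finset.sum_le_sum fun l _ =>
          kmeansF_le_of_norm_sub_le (by omega) _ (min_le_left _ _) (hdist l)
    _ = (1 + η) * ∑ l, kmeansF K (Dm l) (x l) + 2 * η * D.card := by
        rw [Finset.sum_add_distrib, ← Finset.mul_sum, ← Finset.mul_sum, hcard]
    _ ≤ (1 + η) * Fs + 2 * η * D.card := by gcongr
    _ < Fs + δ := by rw [hT] at hηT; nlinarith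
end
end
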